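/- arXiv:1806.08683 — 3 statements merged into one kernel-verified Lean document; each statement's English description precedes it below -/
import Mathlib

section
/- Let Z be a random vector in ℂ^{k-1} (k ≥ 3) with ‖Z‖ = 1 almost surely, and let A = E[ZZ*]. Denote by λ₁ the smallest eigenvalue of the Hermitian matrix A. Then the set of maximizers over unit vectors u ∈ ℂ^{k-1} of the Fréchet function F(u) = E[‖ZZ* − uu*‖_F²] consists, modulo multiplication by unit-modulus scalars, of a single projective point if and only if λ₁ is a simple eigenvalue of A; and in that case the unique maximizing projective point is [ν], where ν is any unit eigenvector of A corresponding to λ₁. (Equivalently: if λ₁ is simple with unit eigenvector ν, then F(u) ≤ F(ν) for all unit u, with equality if and only if u = cν for some c with |c| = 1; if λ₁ has multiplicity ≥ 2, there exist two maximizing unit vectors neither of which is a unit-scalar multiple of the other.) -/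
open MeasureTheory Matrix

/-- Squared Frobenius (Hilbert–Schmidt) norm of a complex matrix. -/
noncomputable def frobSq {n : ℕ} (M : Matrix (Fin n) (Fin n) ℂ) : ℝ :=
  ∑ i, ∑ j, ‖M i j‖ ^ 2

/-- The Veronese–Whitney image `z z*` of a vector `z ∈ ℂⁿ`. -/
noncomputable def vwC {n : ℕ} (z : Fin n → ℂ) : Matrix (Fin n) (Fin n) ℂ :=
  vecMulVec z (star z)

/-- The squared Frobenius distance between two Veronese–Whitney images. -/
theorem frobSq_vwC_sub {n : ℕ} (z u : Fin n → ℂ) :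
    frobSq (vwC z - vwC u) = (∑ i, ‖z i‖ ^ 2) ^ 2 + (∑ i, ‖u i‖ ^ 2) ^ 2
      - 2 * (∑ i, ∑ j, star (u i) * (z i * starRingEnd ℂ (z j) * u j)).re := by
  rw [sq (∑ i, ‖z i‖ ^ 2), sq (∑ i, ‖u i‖ ^ 2), Finset.sum_mul_sum, Finset.sum_mul_sum]
  simp only [frobSq, Complex.re_sum, Finset.mul_sum, ← Finset.sum_add_distrib,
    ← Finset.sum_sub_distrib]
  refine Finset.sum_congr rfl fun i _ => Finset.sum_congr rfl fun j _ => ?_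
  simp only [vwC, Matrix.sub_apply, vecMulVec_apply, Pi.star_apply, RCLike.star_def,
    ← Complex.normSq_eq_norm_sq, Complex.normSq_apply, Complex.sub_re, Complex.sub_im,
    Complex.mul_re, Complex.mul_im, Complex.conj_re, Complex.conj_im]
  ring

/-- A coordinate of a unit vector has norm at most one. -/
theorem norm_coord_le_one {n : ℕ} {z : Fin n → ℂ} (hz : ∑ i, ‖z i‖ ^ 2 = 1) (i : Fin n) :
    ‖z i‖ ≤ 1 := by
  have h : ‖z i‖ ^ 2 ≤ ∑ i, ‖z i‖ ^ 2 :=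
    Finset.single_le_sum (f := fun i => ‖z i‖ ^ 2) (fun _ _ => by positivity) (Finset.mem_univ i)
  rw [hz] at h
  exact (sq_le_one_iff₀ (norm_nonneg _)).1 h

/-- The products of coordinates of a random unit vector are integrable. -/
theorem integrable_coord_mul_conj {n : ℕ} {Ω : Type*} [MeasurableSpace Ω] {μ : Measure Ω}
    [IsFiniteMeasure μ] {Z : Ω → Fin n → ℂ} (hZm : Measurable Z)
    (hZ : ∀ᵐ ω ∂μ, ∑ i, ‖Z ω i‖ ^ 2 = 1) (i j : Fin n) :
    Integrable (fun ω => Z ω i * starRingEnd ℂ (Z ω j)) μ := by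
  have hm (i : Fin n) : Measurable fun ω => Z ω i := (measurable_pi_apply i).comp hZm
  refine Integrable.of_bound
    ((hm i).mul (Complex.continuous_conj.measurable.comp (hm j))).aestronglyMeasurable 1 ?_
  filter_upwards [hZ] with ω hω
  rw [norm_mul, RCLike.norm_conj]
  exact mul_le_one₀ (norm_coord_le_one hω i) (norm_nonneg _) (norm_coord_le_one hω j)

/-- On unit vectors the Fréchet function is `2 - 2 u* A u`. -/
theorem integral_frobSq_vwC_sub {n : ℕ} {Ω : Type*} [MeasurableSpace Ω] {μ : Measure Ω}
    [IsProbabilityMeasure μ] {Z : Ω → Fin n → ℂ} (hZm : Measurable Z)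
    (hZ : ∀ᵐ ω ∂μ, ∑ i, ‖Z ω i‖ ^ 2 = 1) {A : Matrix (Fin n) (Fin n) ℂ}
    (hA : ∀ i j, A i j = ∫ ω, Z ω i * starRingEnd ℂ (Z ω j) ∂μ)
    {u : Fin n → ℂ} (hu : ∑ i, ‖u i‖ ^ 2 = 1) :
    ∫ ω, frobSq (vwC (Z ω) - vwC u) ∂μ = 2 - 2 * (star u ⬝ᵥ A *ᵥ u).re := by
  have hterm (i j : Fin n) :
      Integrable (fun ω => star (u i) * (Z ω i * starRingEnd ℂ (Z ω j) * u j)) μ :=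
    ((integrable_coord_mul_conj hZm hZ i j).mul_const _).const_mul _
  have hrow (i : Fin n) :
      Integrable (fun ω => ∑ j, star (u i) * (Z ω i * starRingEnd ℂ (Z ω j) * u j)) μ :=
    integrable_finsetSum _ fun j _ => hterm i j
  have hsum : Integrable
      (fun ω => ∑ i, ∑ j, star (u i) * (Z ω i * starRingEnd ℂ (Z ω j) * u j)) μ :=
    integrable_finsetSum _ fun i _ => hrow i
  have hquad : star u ⬝ᵥ A *ᵥ u
      = ∫ ω, ∑ i, ∑ j, star (u i) * (Z ω i * starRingEnd ℂ (Z ω j) * u j) ∂μ := by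
    rw [integral_finsetSum _ fun i _ => hrow i]
    simp only [dotProduct, mulVec, Finset.mul_sum, Pi.star_apply]
    refine Finset.sum_congr rfl fun i _ => ?_
    rw [integral_finsetSum _ fun j _ => hterm i j]
    refine Finset.sum_congr rfl fun j _ => ?_
    rw [integral_const_mul, integral_mul_const, hA]
  have hre := integral_re hsum
  simp only [RCLike.re_eq_complex_re] at hre
  rw [hquad, ← hre, ← integral_const_mul]
  have hae : (fun ω => frobSq (vwC (Z ω) - vwC u)) =ᵐ[μ] fun ω =>
      2 - 2 * (∑ i, ∑ j, star (u i) * (Z ω i * starRingEnd ℂ (Z ω j) * u j)).re := by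
    filter_upwards [hZ] with ω hω
    rw [frobSq_vwC_sub, hω, hu]
    norm_num
  have hre_int : Integrable (fun ω =>
      2 * (∑ i, ∑ j, star (u i) * (Z ω i * starRingEnd ℂ (Z ω j) * u j)).re) μ :=
    hsum.re.const_mul 2
  rw [integral_congr_ae hae, integral_sub (integrable_const _) hre_int]
  simp

/-- The second moment matrix of a random vector is Hermitian. -/
theorem isHermitian_of_secondMoment {n : ℕ} {Ω : Type*} [MeasurableSpace Ω] {μ : Measure Ω}
    {Z : Ω → Fin n → ℂ} {A : Matrix (Fin n) (Fin n) ℂ}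
    (hA : ∀ i j, A i j = ∫ ω, Z ω i * starRingEnd ℂ (Z ω j) ∂μ) : A.IsHermitian := by
  refine Matrix.IsHermitian.ext fun i j => ?_
  rw [hA, hA, RCLike.star_def, ← integral_conj]
  simp [mul_comm]

open scoped ComplexOrder in
/-- Subtracting a lower bound of its real eigenvalues makes a Hermitian matrix positive
semidefinite. -/
theorem posSemidef_sub_smul_one {n : ℕ} {A : Matrix (Fin n) (Fin n) ℂ} (hA : A.IsHermitian)
    {lam : ℝ} (hmin : ∀ mu : ℝ, (∃ w, w ≠ 0 ∧ A *ᵥ w = (mu : ℂ) • w) → lam ≤ mu) :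
    (A - (lam : ℂ) • (1 : Matrix (Fin n) (Fin n) ℂ)).PosSemidef := by
  have hB : (A - (lam : ℂ) • (1 : Matrix (Fin n) (Fin n) ℂ)).IsHermitian := by
    refine hA.sub ?_
    simp [Matrix.IsHermitian, conjTranspose_smul]
  rw [hB.posSemidef_iff_eigenvalues_nonneg]
  intro i
  have h := hB.mulVec_eigenvectorBasis i
  rw [sub_mulVec, smul_mulVec, one_mulVec, sub_eq_iff_eq_add] at h
  have hle := hmin (hB.eigenvalues i + lam) ⟨hB.eigenvectorBasis i, ?_, ?_⟩
  · simpa using hle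
  · intro h0
    exact hB.eigenvectorBasis.orthonormal.ne_zero i (by ext j; exact congrFun h0 j)
  · rw [h]
    ext j
    simp [add_mul]

/-- The Hermitian square of a vector is the sum of the squared norms of its coordinates. -/
theorem star_dotProduct_self_eq {n : ℕ} (u : Fin n → ℂ) :
    star u ⬝ᵥ u = ((∑ i, ‖u i‖ ^ 2 : ℝ) : ℂ) := by
  simp [dotProduct, Complex.conj_mul']

/-- The value of the shifted quadratic form at a unit vector. -/
theorem quadForm_sub_smul_one {n : ℕ} (A : Matrix (Fin n) (Fin n) ℂ) (lam : ℝ)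
    {u : Fin n → ℂ} (hu : ∑ i, ‖u i‖ ^ 2 = 1) :
    star u ⬝ᵥ (A - (lam : ℂ) • (1 : Matrix (Fin n) (Fin n) ℂ)) *ᵥ u
      = star u ⬝ᵥ A *ᵥ u - lam := by
  rw [sub_mulVec, smul_mulVec, one_mulVec, dotProduct_sub, dotProduct_smul,
    star_dotProduct_self_eq, hu]
  simp

open scoped ComplexOrder in
/-- On unit vectors a Hermitian form is bounded below by any lower bound of its eigenvalues. -/
theorem le_re_quadForm {n : ℕ} {A : Matrix (Fin n) (Fin n) ℂ} (hA : A.IsHermitian)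
    {lam : ℝ} (hmin : ∀ mu : ℝ, (∃ w, w ≠ 0 ∧ A *ᵥ w = (mu : ℂ) • w) → lam ≤ mu)
    {u : Fin n → ℂ} (hu : ∑ i, ‖u i‖ ^ 2 = 1) : lam ≤ (star u ⬝ᵥ A *ᵥ u).re := by
  have h := (Complex.le_def.1 ((posSemidef_sub_smul_one hA hmin).dotProduct_mulVec_nonneg u)).1
  rw [quadForm_sub_smul_one A lam hu] at h
  simpa using h

open scoped ComplexOrder in
/-- A unit vector attains the lower bound `lam` exactly when it is an eigenvector for `lam`. -/
theorem re_quadForm_eq_iff {n : ℕ} {A : Matrix (Fin n) (Fin n) ℂ} (hA : A.IsHermitian)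
    {lam : ℝ} (hmin : ∀ mu : ℝ, (∃ w, w ≠ 0 ∧ A *ᵥ w = (mu : ℂ) • w) → lam ≤ mu)
    {u : Fin n → ℂ} (hu : ∑ i, ‖u i‖ ^ 2 = 1) :
    (star u ⬝ᵥ A *ᵥ u).re = lam ↔ A *ᵥ u = (lam : ℂ) • u := by
  have hP := posSemidef_sub_smul_one hA hmin
  have hker := hP.dotProduct_mulVec_zero_iff u
  have him := (Complex.le_def.1 (hP.dotProduct_mulVec_nonneg u)).2
  rw [quadForm_sub_smul_one A lam hu] at hker him
  rw [sub_mulVec, smul_mulVec, one_mulVec, sub_eq_zero (b := (lam : ℂ) • u)] at hker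
  rw [← hker, Complex.ext_iff, ← him, Complex.sub_re, Complex.ofReal_re, Complex.zero_re,
    sub_eq_zero]
  simp

theorem sum_norm_sq_smul {n : ℕ} (c : ℂ) (u : Fin n → ℂ) :
    ∑ i, ‖(c • u) i‖ ^ 2 = ‖c‖ ^ 2 * ∑ i, ‖u i‖ ^ 2 := by
  simp [mul_pow, Finset.mul_sum]

/-- Every nonzero vector has a nonzero multiple which is a unit vector. -/
theorem exists_smul_unit {n : ℕ} {v : Fin n → ℂ} (hv : v ≠ 0) :
    ∃ c : ℂ, c ≠ 0 ∧ ∑ i, ‖(c • v) i‖ ^ 2 = 1 := by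
  have hpos : 0 < ∑ i, ‖v i‖ ^ 2 := by
    obtain ⟨i, hi⟩ := Function.ne_iff.1 hv
    exact Finset.sum_pos' (fun _ _ => by positivity)
      ⟨i, Finset.mem_univ i, pow_pos (norm_pos_iff.2 hi) 2⟩
  refine ⟨((√(∑ i, ‖v i‖ ^ 2))⁻¹ : ℝ), ?_, ?_⟩
  · exact_mod_cast (inv_pos.2 (Real.sqrt_pos.2 hpos)).ne'
  · rw [sum_norm_sq_smul, Complex.norm_real, Real.norm_eq_abs, sq_abs, inv_pow,
      Real.sq_sqrt hpos.le, inv_mul_cancel₀ hpos.ne']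

/-- Let `Z` be a random unit vector in `ℂ^(k-1)`, `A = E[ZZ*]`, and `lam` the
smallest eigenvalue of `A`.  The maximizers over unit vectors of the Fréchet function
`F(u) = E[‖ZZ* − uu*‖_F²]` form a single projective point iff `lam` is simple:
(i) if `lam` is simple with unit eigenvector `ν`, then `F u ≤ F ν` for every unit `u`, with
equality iff `u = c • ν` for a unit-modulus scalar `c`; (ii) if `lam` has multiplicity `≥ 2`,
there are two maximizing unit vectors neither of which is a unit-scalar multiple of the
other. -/
theorem stmt1 {k : ℕ} (hk : 3 ≤ k) {Ω : Type*} [MeasurableSpace Ω]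
    (μ : Measure Ω) [IsProbabilityMeasure μ]
    (Z : Ω → Fin (k - 1) → ℂ) (hZm : Measurable Z)
    (hZ : ∀ᵐ ω ∂μ, ∑ i, ‖Z ω i‖ ^ 2 = 1)
    (A : Matrix (Fin (k - 1)) (Fin (k - 1)) ℂ)
    (hA : ∀ i j, A i j = ∫ ω, Z ω i * (starRingEnd ℂ) (Z ω j) ∂μ)
    (F : (Fin (k - 1) → ℂ) → ℝ)
    (hF : ∀ u, F u = ∫ ω, frobSq (vwC (Z ω) - vwC u) ∂μ)
    (lam : ℝ)
    (hlameig : ∃ w, w ≠ 0 ∧ A.mulVec w = (lam : ℂ) • w)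
    (hlammin : ∀ mu : ℝ, (∃ w, w ≠ 0 ∧ A.mulVec w = (mu : ℂ) • w) → lam ≤ mu) :
    (∀ ν : Fin (k - 1) → ℂ, (∑ i, ‖ν i‖ ^ 2 = 1) → A.mulVec ν = (lam : ℂ) • ν →
      (∀ w, A.mulVec w = (lam : ℂ) • w → ∃ c : ℂ, w = c • ν) →
      ∀ u : Fin (k - 1) → ℂ, (∑ i, ‖u i‖ ^ 2 = 1) →
        F u ≤ F ν ∧ (F u = F ν ↔ ∃ c : ℂ, ‖c‖ = 1 ∧ u = c • ν))
    ∧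
    ((∃ v w : Fin (k - 1) → ℂ, v ≠ 0 ∧ A.mulVec v = (lam : ℂ) • v ∧
        A.mulVec w = (lam : ℂ) • w ∧ ∀ c : ℂ, w ≠ c • v) →
      ∃ u v : Fin (k - 1) → ℂ, (∑ i, ‖u i‖ ^ 2 = 1) ∧ (∑ i, ‖v i‖ ^ 2 = 1) ∧
        (∀ w : Fin (k - 1) → ℂ, (∑ i, ‖w i‖ ^ 2 = 1) → F w ≤ F u) ∧ F v = F u ∧
        ∀ c : ℂ, ‖c‖ = 1 → v ≠ c • u) := by
  have hAh := isHermitian_of_secondMoment hA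
  have hFu (u : Fin (k - 1) → ℂ) (hu : ∑ i, ‖u i‖ ^ 2 = 1) :
      F u = 2 - 2 * (star u ⬝ᵥ A *ᵥ u).re :=
    (hF u).trans (integral_frobSq_vwC_sub hZm hZ hA hu)
  have hle (u : Fin (k - 1) → ℂ) (hu : ∑ i, ‖u i‖ ^ 2 = 1) : F u ≤ 2 - 2 * lam := by
    linarith [hFu u hu, le_re_quadForm hAh hlammin hu]
  have heq (u : Fin (k - 1) → ℂ) (hu : ∑ i, ‖u i‖ ^ 2 = 1) :
      F u = 2 - 2 * lam ↔ A *ᵥ u = (lam : ℂ) • u := by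
    rw [← re_quadForm_eq_iff hAh hlammin hu, hFu u hu]
    constructor <;> intro h <;> linarith
  refine ⟨fun ν hν hAν hsimple u hu => ?_, ?_⟩
  · rw [(heq ν hν).2 hAν, heq u hu]
    refine ⟨hle u hu, fun h => ?_, ?_⟩
    · obtain ⟨c, rfl⟩ := hsimple u h
      rw [sum_norm_sq_smul, hν, mul_one] at hu
      exact ⟨c, (pow_eq_one_iff_of_nonneg (norm_nonneg c) two_ne_zero).1 hu, rfl⟩
    · rintro ⟨c, -, rfl⟩
      rw [mulVec_smul, hAν, smul_comm]
  · rintro ⟨v, w, hv, hAv, hAw, hvw⟩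
    have hw : w ≠ 0 := fun h => hvw 0 (by simp [h])
    obtain ⟨a, -, hav⟩ := exists_smul_unit hv
    obtain ⟨b, hb, hbw⟩ := exists_smul_unit hw
    have hFa := (heq _ hav).2 (by rw [mulVec_smul, hAv, smul_comm])
    have hFb := (heq _ hbw).2 (by rw [mulVec_smul, hAw, smul_comm])
    refine ⟨a • v, b • w, hav, hbw, fun x hx => hFa ▸ hle x hx, hFb.trans hFa.symm,
      fun c _ h => hvw (b⁻¹ * (c * a)) ?_⟩
    rw [mul_smul, mul_smul, ← h, inv_smul_smul₀ hb]
end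

section
/- Let A be a real symmetric N×N matrix. The set of farthest points from A (in Frobenius distance) in the set {xx^T : x ∈ ℝ^N, ‖x‖ = 1} is a single point if and only if the smallest eigenvalue λ₁ of A is simple; in that case the unique farthest point is νν^T, where ν is a unit eigenvector of A for λ₁. In particular, for a random unit vector X in ℝ^N, the random axis [X] on ℝP^{N-1} is αVW-nonfocal if and only if the smallest eigenvalue of E[XX^T] has multiplicity 1. -/
open MeasureTheory Matrix

/-- Squared Frobenius norm of a real matrix. -/
def frobSqR {N : ℕ} (M : Matrix (Fin N) (Fin N) ℝ) : ℝ :=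
  ∑ i, ∑ j, (M i j) ^ 2

/-- The VW-embedded real projective space: the set of matrices `x xᵀ` with `x` a unit
vector of `ℝ^N`. -/
def vwSphereR (N : ℕ) : Set (Matrix (Fin N) (Fin N) ℝ) :=
  {P | ∃ x : Fin N → ℝ, (∑ i, x i ^ 2 = 1) ∧ P = vecMulVec x x}

/-- `P` is a farthest point from `A` (in Frobenius distance) on the VW-embedded real
projective space. -/
def IsFarthestR {N : ℕ} (A P : Matrix (Fin N) (Fin N) ℝ) : Prop :=
  P ∈ vwSphereR N ∧ ∀ Q ∈ vwSphereR N, frobSqR (A - Q) ≤ frobSqR (A - P)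

/-- `lam` is the smallest eigenvalue of `A` and it is simple (multiplicity one). -/
def SmallestEigSimpleR {N : ℕ} (A : Matrix (Fin N) (Fin N) ℝ) (lam : ℝ) : Prop :=
  (∃ v, v ≠ 0 ∧ A.mulVec v = lam • v) ∧
  (∀ mu : ℝ, (∃ v, v ≠ 0 ∧ A.mulVec v = mu • v) → lam ≤ mu) ∧
  (∀ v w, v ≠ 0 → A.mulVec v = lam • v → A.mulVec w = lam • w → ∃ c : ℝ, w = c • v)

lemma sum_sq_eq_dotProduct {N : ℕ} (x : Fin N → ℝ) : ∑ i, x i ^ 2 = x ⬝ᵥ x := by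
  simp [dotProduct, sq]

lemma frobSqR_sub_vecMulVec {N : ℕ} (A : Matrix (Fin N) (Fin N) ℝ) (x : Fin N → ℝ)
    (hx : ∑ i, x i ^ 2 = 1) :
    frobSqR (A - vecMulVec x x) = frobSqR A - 2 * (x ⬝ᵥ A *ᵥ x) + 1 := by
  have h : ∑ i, ∑ j, (x i * x j) ^ 2 = 1 := by
    simp_rw [mul_pow, ← Finset.mul_sum, hx, mul_one, hx]
  rw [← h]
  simp only [frobSqR, dotProduct, mulVec, Finset.mul_sum, ← Finset.sum_sub_distrib,
    ← Finset.sum_add_distrib, Matrix.sub_apply, vecMulVec_apply]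
  refine Finset.sum_congr rfl fun i _ => Finset.sum_congr rfl fun j _ => ?_
  ring

lemma isFarthestR_vecMulVec_iff {N : ℕ} (A : Matrix (Fin N) (Fin N) ℝ) (x : Fin N → ℝ)
    (hx : ∑ i, x i ^ 2 = 1) :
    IsFarthestR A (vecMulVec x x) ↔
      ∀ y : Fin N → ℝ, ∑ i, y i ^ 2 = 1 → x ⬝ᵥ A *ᵥ x ≤ y ⬝ᵥ A *ᵥ y := by
  constructor
  · rintro ⟨-, h⟩ y hy
    have := h _ ⟨y, hy, rfl⟩
    rw [frobSqR_sub_vecMulVec A x hx, frobSqR_sub_vecMulVec A y hy] at this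
    linarith
  · intro h
    refine ⟨⟨x, hx, rfl⟩, ?_⟩
    rintro _ ⟨y, hy, rfl⟩
    rw [frobSqR_sub_vecMulVec A x hx, frobSqR_sub_vecMulVec A y hy]
    linarith [h y hy]

lemma exists_smul_sum_sq_eq_one {N : ℕ} {v : Fin N → ℝ} (hv : v ≠ 0) :
    ∃ r : ℝ, r ≠ 0 ∧ ∑ i, (r • v) i ^ 2 = 1 := by
  have h0 : 0 < v ⬝ᵥ v := by
    have := (dotProduct_star_self_pos_iff (v := v)).2 hv
    simpa using this
  refine ⟨(√(v ⬝ᵥ v))⁻¹, inv_ne_zero (Real.sqrt_pos.2 h0).ne', ?_⟩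
  rw [sum_sq_eq_dotProduct, smul_dotProduct, dotProduct_smul, smul_smul, smul_eq_mul,
    ← mul_inv, Real.mul_self_sqrt h0.le, inv_mul_cancel₀ h0.ne']

lemma posSemidef_sub_smul_one_s7 {N : ℕ} {A : Matrix (Fin N) (Fin N) ℝ} (hA : A.IsSymm) {m : ℝ}
    (h : ∀ y : Fin N → ℝ, ∑ i, y i ^ 2 = 1 → m ≤ y ⬝ᵥ A *ᵥ y) :
    (A - m • (1 : Matrix (Fin N) (Fin N) ℝ)).PosSemidef := by
  refine PosSemidef.of_dotProduct_mulVec_nonneg ?_ fun y => ?_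
  · rw [IsHermitian, conjTranspose_eq_transpose_of_trivial]
    simp [hA.eq]
  · by_cases hy : y = 0
    · simp [hy]
    obtain ⟨r, hr, hry⟩ := exists_smul_sum_sq_eq_one hy
    have h1 := h _ hry
    rw [sum_sq_eq_dotProduct] at hry
    simp only [mulVec_smul, smul_dotProduct, dotProduct_smul, smul_eq_mul] at h1 hry
    simp only [star_trivial, sub_mulVec, smul_mulVec, one_mulVec, dotProduct_sub,
      dotProduct_smul, smul_eq_mul]
    have hr2 : 0 < r * r := mul_self_pos.2 hr
    refine nonneg_of_mul_nonneg_right (a := r * r) ?_ hr2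
    linear_combination h1 + m * hry

lemma mulVec_eq_smul_of_rayleigh_le {N : ℕ} {A : Matrix (Fin N) (Fin N) ℝ} (hA : A.IsSymm)
    {m : ℝ} (h : ∀ y : Fin N → ℝ, ∑ i, y i ^ 2 = 1 → m ≤ y ⬝ᵥ A *ᵥ y) {x : Fin N → ℝ}
    (hx : ∑ i, x i ^ 2 = 1) (hxm : x ⬝ᵥ A *ᵥ x = m) : A *ᵥ x = m • x := by
  have h0 := ((posSemidef_sub_smul_one_s7 hA h).dotProduct_mulVec_zero_iff x).1 (by
    rw [sum_sq_eq_dotProduct] at hx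
    simp [sub_mulVec, smul_mulVec, dotProduct_sub, hx, hxm])
  rwa [sub_mulVec, smul_mulVec, one_mulVec, sub_eq_zero] at h0

lemma rayleigh_of_mulVec_eq_smul {N : ℕ} {A : Matrix (Fin N) (Fin N) ℝ} {m : ℝ}
    {x : Fin N → ℝ} (hx : ∑ i, x i ^ 2 = 1) (h : A *ᵥ x = m • x) : x ⬝ᵥ A *ᵥ x = m := by
  rw [h, dotProduct_smul, ← sum_sq_eq_dotProduct, hx, smul_eq_mul, mul_one]

lemma ne_zero_of_sum_sq_eq_one {N : ℕ} {x : Fin N → ℝ} (hx : ∑ i, x i ^ 2 = 1) : x ≠ 0 := by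
  rintro rfl
  simp at hx

lemma isCompact_setOf_sum_sq_eq_one (N : ℕ) :
    IsCompact {x : Fin N → ℝ | ∑ i, x i ^ 2 = 1} := by
  refine Metric.isCompact_of_isClosed_isBounded
    (isClosed_eq (by fun_prop) continuous_const)
    (Metric.isBounded_closedBall (x := (0 : Fin N → ℝ)) (r := 1) |>.subset fun x hx => ?_)
  rw [mem_closedBall_zero_iff, pi_norm_le_iff_of_nonneg zero_le_one]
  intro i
  rw [Real.norm_eq_abs, ← sq_le_one_iff_abs_le_one]
  exact (Finset.single_le_sum (f := fun i => x i ^ 2) (fun j _ => sq_nonneg _)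
    (Finset.mem_univ i)).trans_eq hx

lemma le_rayleigh_of_le_eigenvalues {N : ℕ} {A : Matrix (Fin N) (Fin N) ℝ} (hA : A.IsSymm)
    {lam : ℝ} (hmin : ∀ mu : ℝ, (∃ v, v ≠ 0 ∧ A *ᵥ v = mu • v) → lam ≤ mu)
    {y : Fin N → ℝ} (hy : ∑ i, y i ^ 2 = 1) : lam ≤ y ⬝ᵥ A *ᵥ y := by
  obtain ⟨x, hx, hxmin⟩ := (isCompact_setOf_sum_sq_eq_one N).exists_isMinOn ⟨y, hy⟩
    (f := fun y => y ⬝ᵥ A *ᵥ y)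
    (continuous_id.dotProduct
      (continuous_const.matrix_mulVec continuous_id)).continuousOn
  exact (hmin _ ⟨x, ne_zero_of_sum_sq_eq_one hx, mulVec_eq_smul_of_rayleigh_le hA
    (fun z hz => hxmin hz) hx rfl⟩).trans (hxmin hy)

/-- The farthest points from `A` come exactly from the unit eigenvectors of the smallest
eigenvalue. -/
lemma isFarthestR_vecMulVec_iff_mulVec_eq {N : ℕ} {A : Matrix (Fin N) (Fin N) ℝ}
    (hA : A.IsSymm) {lam : ℝ} (heig : ∃ v, v ≠ 0 ∧ A *ᵥ v = lam • v)
    (hmin : ∀ mu : ℝ, (∃ v, v ≠ 0 ∧ A *ᵥ v = mu • v) → lam ≤ mu)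
    {x : Fin N → ℝ} (hx : ∑ i, x i ^ 2 = 1) :
    IsFarthestR A (vecMulVec x x) ↔ A *ᵥ x = lam • x := by
  rw [isFarthestR_vecMulVec_iff A x hx]
  constructor
  · intro h
    obtain ⟨v, hv, hAv⟩ := heig
    obtain ⟨r, -, hr⟩ := exists_smul_sum_sq_eq_one hv
    have hrv : (r • v) ⬝ᵥ A *ᵥ (r • v) = lam :=
      rayleigh_of_mulVec_eq_smul hr (by rw [mulVec_smul, hAv, smul_comm])
    exact mulVec_eq_smul_of_rayleigh_le hA (fun y hy => le_rayleigh_of_le_eigenvalues hA hmin hy)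
      hx (le_antisymm (hrv ▸ h _ hr) (le_rayleigh_of_le_eigenvalues hA hmin hx))
  · intro h y hy
    rw [rayleigh_of_mulVec_eq_smul hx h]
    exact le_rayleigh_of_le_eigenvalues hA hmin hy

lemma eq_vecMulVec_of_smallestEigSimpleR {N : ℕ} {A : Matrix (Fin N) (Fin N) ℝ}
    (hA : A.IsSymm) {lam : ℝ} (h : SmallestEigSimpleR A lam) {ν : Fin N → ℝ}
    (hν : ∑ i, ν i ^ 2 = 1) (hAν : A *ᵥ ν = lam • ν) {P : Matrix (Fin N) (Fin N) ℝ}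
    (hP : IsFarthestR A P) : P = vecMulVec ν ν := by
  obtain ⟨w, hw, rfl⟩ := hP.1
  have hAw := (isFarthestR_vecMulVec_iff_mulVec_eq hA h.1 h.2.1 hw).1 hP
  obtain ⟨c, rfl⟩ := h.2.2 ν w (ne_zero_of_sum_sq_eq_one hν) hAν hAw
  have hc : c * c = 1 := by
    rw [sum_sq_eq_dotProduct] at hν hw
    simpa [hν] using hw
  rw [smul_vecMulVec, vecMulVec_smul, smul_smul, hc, one_smul]

lemma existsUnique_isFarthestR_iff {N : ℕ} {A : Matrix (Fin N) (Fin N) ℝ}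
    (hA : A.IsSymm) {lam : ℝ} (heig : ∃ v, v ≠ 0 ∧ A *ᵥ v = lam • v)
    (hmin : ∀ mu : ℝ, (∃ v, v ≠ 0 ∧ A *ᵥ v = mu • v) → lam ≤ mu) :
    (∃! P, IsFarthestR A P) ↔ SmallestEigSimpleR A lam := by
  constructor
  · intro hu
    refine ⟨heig, hmin, fun v w hv hAv hAw => ?_⟩
    by_cases hw : w = 0
    · exact ⟨0, by simp [hw]⟩
    obtain ⟨r, hr, hrv⟩ := exists_smul_sum_sq_eq_one hv
    obtain ⟨s, hs, hsw⟩ := exists_smul_sum_sq_eq_one hw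
    have h := hu.unique
      ((isFarthestR_vecMulVec_iff_mulVec_eq hA heig hmin hrv).2
        (by rw [mulVec_smul, hAv, smul_comm]))
      ((isFarthestR_vecMulVec_iff_mulVec_eq hA heig hmin hsw).2
        (by rw [mulVec_smul, hAw, smul_comm]))
    have h2 := congrArg (fun B => B *ᵥ (s • w)) h
    simp only [vecMulVec_mulVec, op_smul_eq_smul] at h2
    rw [← sum_sq_eq_dotProduct, hsw, one_smul] at h2
    refine ⟨s⁻¹ * ((r • v) ⬝ᵥ (s • w) * r), ?_⟩
    rw [mul_smul, mul_smul, h2, inv_smul_smul₀ hs]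
  · intro h
    obtain ⟨v, hv, hAv⟩ := heig
    obtain ⟨r, hr, hrv⟩ := exists_smul_sum_sq_eq_one hv
    have hArv : A *ᵥ (r • v) = lam • r • v := by rw [mulVec_smul, hAv, smul_comm]
    exact ⟨_, (isFarthestR_vecMulVec_iff_mulVec_eq hA h.1 hmin hrv).2 hArv,
      fun P hP => eq_vecMulVec_of_smallestEigSimpleR hA h hrv hArv hP⟩

lemma existsUnique_isFarthestR_iff_exists {N : ℕ} {A : Matrix (Fin N) (Fin N) ℝ}
    (hA : A.IsSymm) :
    (∃! P, IsFarthestR A P) ↔ ∃ mu : ℝ, SmallestEigSimpleR A mu := by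
  refine ⟨fun hu => ?_, fun ⟨mu, h⟩ => (existsUnique_isFarthestR_iff hA h.1 h.2.1).2 h⟩
  obtain ⟨P, hP, -⟩ := id hu
  obtain ⟨x, hx, rfl⟩ := hP.1
  have hmin := (isFarthestR_vecMulVec_iff A x hx).1 hP
  refine ⟨x ⬝ᵥ A *ᵥ x, (existsUnique_isFarthestR_iff hA ⟨x, ne_zero_of_sum_sq_eq_one hx,
    mulVec_eq_smul_of_rayleigh_le hA hmin hx rfl⟩ ?_).1 hu⟩
  rintro mu ⟨v, hv, hAv⟩
  obtain ⟨r, -, hr⟩ := exists_smul_sum_sq_eq_one hv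
  rw [← rayleigh_of_mulVec_eq_smul hr (by rw [mulVec_smul, hAv, smul_comm] :
    A *ᵥ (r • v) = mu • r • v)]
  exact hmin _ hr

/-- For a real symmetric matrix `A` with smallest eigenvalue `lam`, the set of
farthest points from `A` on `{xxᵀ : ‖x‖ = 1}` is a single point iff `lam` is simple, in which
case the unique farthest point is `ννᵀ` for `ν` a unit eigenvector of `lam`.  In particular,
for a random unit vector `X` in `ℝ^N`, the axis `[X]` is αVW-nonfocal (i.e. `E[XXᵀ]` has a
unique farthest point on the embedded projective space) iff the smallest eigenvalue of
`E[XXᵀ]` has multiplicity 1. -/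
theorem stmt7 {N : ℕ} (A : Matrix (Fin N) (Fin N) ℝ) (hA : A.IsSymm)
    (lam : ℝ)
    (hlameig : ∃ v, v ≠ 0 ∧ A.mulVec v = lam • v)
    (hlammin : ∀ mu : ℝ, (∃ v, v ≠ 0 ∧ A.mulVec v = mu • v) → lam ≤ mu)
    {Ω : Type*} [MeasurableSpace Ω] (μ : Measure Ω) [IsProbabilityMeasure μ]
    (X : Ω → Fin N → ℝ) (hXm : Measurable X)
    (hX : ∀ᵐ ω ∂μ, ∑ i, X ω i ^ 2 = 1)
    (M : Matrix (Fin N) (Fin N) ℝ)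
    (hM : ∀ i j, M i j = ∫ ω, X ω i * X ω j ∂μ) :
    ((∃! P, IsFarthestR A P) ↔ SmallestEigSimpleR A lam)
    ∧
    (∀ ν : Fin N → ℝ, (∑ i, ν i ^ 2 = 1) → A.mulVec ν = lam • ν →
      SmallestEigSimpleR A lam →
      IsFarthestR A (vecMulVec ν ν) ∧ ∀ P, IsFarthestR A P → P = vecMulVec ν ν)
    ∧
    ((∃! P, IsFarthestR M P) ↔ ∃ mu : ℝ, SmallestEigSimpleR M mu) := by
  refine ⟨existsUnique_isFarthestR_iff hA hlameig hlammin, fun ν hν hAν h => ⟨?_, fun P hP =>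
    eq_vecMulVec_of_smallestEigSimpleR hA h hν hAν hP⟩, existsUnique_isFarthestR_iff_exists ?_⟩
  · exact (isFarthestR_vecMulVec_iff_mulVec_eq hA hlameig hlammin hν).2 hAν
  · ext i j
    simp only [transpose_apply, hM, mul_comm]
end

section
/- Let x₁, …, x_n ∈ ℝ^N be unit vectors and set K = (1/n) Σ_{r=1}^n x_r x_r^T. If the smallest eigenvalue of the symmetric matrix K is simple, with unit eigenvector m, then the maximizers over unit vectors u ∈ ℝ^N of the empirical Fréchet function F_n(u) = (1/n) Σ_{r=1}^n ‖x_r x_r^T − uu^T‖_F² are exactly m and −m; that is, the sample VW antimean on ℝP^{N-1} is the axis [m]. -/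
open Matrix

/-- A real symmetric matrix minus a lower bound for its eigenvalues is positive semidefinite. -/
theorem posSemidef_sub_smul_one_s9 {N : ℕ} {K : Matrix (Fin N) (Fin N) ℝ} (hK : K.IsHermitian)
    {lam : ℝ} (hmin : ∀ mu : ℝ, (∃ w, w ≠ 0 ∧ K.mulVec w = mu • w) → lam ≤ mu) :
    (K - lam • (1 : Matrix (Fin N) (Fin N) ℝ)).PosSemidef := by
  have hB : (K - lam • (1 : Matrix (Fin N) (Fin N) ℝ)).IsHermitian := by
    refine hK.sub ?_
    simp [IsHermitian]
  rw [hB.posSemidef_iff_eigenvalues_nonneg]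
  intro i
  have h := hB.mulVec_eigenvectorBasis i
  rw [sub_mulVec, smul_mulVec, one_mulVec, sub_eq_iff_eq_add, ← add_smul] at h
  have h0 : (hB.eigenvectorBasis i).ofLp ≠ 0 := fun h0 =>
    hB.eigenvectorBasis.orthonormal.ne_zero i (by ext j; exact congrFun h0 j)
  have := hmin _ ⟨_, h0, h⟩
  simpa using this

theorem frobSqR_vecMulVec_sub {N : ℕ} (x u : Fin N → ℝ) :
    frobSqR (vecMulVec x x - vecMulVec u u) =
      (x ⬝ᵥ x) ^ 2 - 2 * (x ⬝ᵥ u) ^ 2 + (u ⬝ᵥ u) ^ 2 := by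
  have h : ∀ a b : Fin N → ℝ, (a ⬝ᵥ b) ^ 2 = ∑ i, ∑ j, (a i * b i) * (a j * b j) := by
    intro a b
    rw [sq, dotProduct, Finset.sum_mul_sum]
  simp only [frobSqR, h, Finset.mul_sum, ← Finset.sum_sub_distrib, ← Finset.sum_add_distrib,
    Matrix.sub_apply, vecMulVec_apply]
  refine Finset.sum_congr rfl fun i _ => Finset.sum_congr rfl fun j _ => ?_
  ring

theorem dotProduct_self_eq_sum_sq {N : ℕ} (u : Fin N → ℝ) : u ⬝ᵥ u = ∑ i, u i ^ 2 := by
  simp only [dotProduct, sq]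

theorem dotProduct_smul_sum_vecMulVec_mulVec {N n : ℕ} (c : ℝ) (x : Fin n → Fin N → ℝ)
    (u : Fin N → ℝ) :
    u ⬝ᵥ (c • ∑ r, vecMulVec (x r) (x r)) *ᵥ u = c * ∑ r, (x r ⬝ᵥ u) ^ 2 := by
  rw [smul_mulVec, dotProduct_smul, sum_mulVec, dotProduct_sum, smul_eq_mul]
  congr 1
  refine Finset.sum_congr rfl fun r _ => ?_
  rw [vecMulVec_mulVec, op_smul_eq_smul, dotProduct_smul, smul_eq_mul, dotProduct_comm u, sq]

/-- For unit vectors `x₁, …, x_n ∈ ℝ^N` and `K = (1/n) Σ x_r x_rᵀ`, if the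
smallest eigenvalue of `K` is simple with unit eigenvector `m`, then the maximizers over unit
vectors `u` of the empirical Fréchet function `F_n(u) = (1/n) Σ ‖x_r x_rᵀ − uuᵀ‖_F²` are
exactly `m` and `−m`; i.e. the sample VW antimean on `ℝP^(N-1)` is the axis `[m]`. -/
theorem stmt9 {N : ℕ} {n : ℕ} (hn : 0 < n)
    (x : Fin n → Fin N → ℝ) (hx : ∀ r, ∑ i, x r i ^ 2 = 1)
    (K : Matrix (Fin N) (Fin N) ℝ)
    (hK : K = (n : ℝ)⁻¹ • ∑ r, vecMulVec (x r) (x r))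
    (lam : ℝ) (m : Fin N → ℝ) (hm : ∑ i, m i ^ 2 = 1)
    (hmeig : K.mulVec m = lam • m)
    (hmin : ∀ mu : ℝ, (∃ w, w ≠ 0 ∧ K.mulVec w = mu • w) → lam ≤ mu)
    (hsimple : ∀ w, K.mulVec w = lam • w → ∃ c : ℝ, w = c • m)
    (Fn : (Fin N → ℝ) → ℝ)
    (hFn : ∀ u, Fn u = (n : ℝ)⁻¹ * ∑ r, frobSqR (vecMulVec (x r) (x r) - vecMulVec u u)) :
    ∀ u : Fin N → ℝ, (∑ i, u i ^ 2 = 1) →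
      ((∀ w : Fin N → ℝ, (∑ i, w i ^ 2 = 1) → Fn w ≤ Fn u) ↔ (u = m ∨ u = -m)) := by
  have hn' : (n : ℝ) ≠ 0 := by exact_mod_cast hn.ne'
  have hherm : K.IsHermitian := by
    rw [hK]
    ext i j
    simp [Matrix.sum_apply, vecMulVec_apply, mul_comm]
  have hF : ∀ u : Fin N → ℝ, (∑ i, u i ^ 2 = 1) → Fn u = 2 - 2 * (u ⬝ᵥ K *ᵥ u) := by
    intro u hu
    rw [hFn, hK, dotProduct_smul_sum_vecMulVec_mulVec]
    simp only [frobSqR_vecMulVec_sub, dotProduct_self_eq_sum_sq, hx, hu,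
      Finset.sum_add_distrib, Finset.sum_sub_distrib, ← Finset.mul_sum]
    simp
    field_simp
    ring
  have hpsd := posSemidef_sub_smul_one_s9 hherm hmin
  have hquad : ∀ u : Fin N → ℝ, (∑ i, u i ^ 2 = 1) →
      u ⬝ᵥ (K - lam • (1 : Matrix (Fin N) (Fin N) ℝ)) *ᵥ u = u ⬝ᵥ K *ᵥ u - lam := by
    intro u hu
    rw [sub_mulVec, smul_mulVec, one_mulVec, dotProduct_sub, dotProduct_smul,
      dotProduct_self_eq_sum_sq u, hu, smul_eq_mul, mul_one]
  have hge : ∀ u : Fin N → ℝ, (∑ i, u i ^ 2 = 1) → lam ≤ u ⬝ᵥ K *ᵥ u := by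
    intro u hu
    have h := hpsd.dotProduct_mulVec_nonneg u
    rw [star_trivial, hquad u hu] at h
    linarith
  have hKm : m ⬝ᵥ K *ᵥ m = lam := by
    rw [hmeig, dotProduct_smul, dotProduct_self_eq_sum_sq, hm, smul_eq_mul, mul_one]
  intro u hu
  constructor
  · intro hmax
    have h1 := hmax m hm
    rw [hF m hm, hF u hu, hKm] at h1
    have h2 : star u ⬝ᵥ (K - lam • (1 : Matrix (Fin N) (Fin N) ℝ)) *ᵥ u = 0 := by
      rw [star_trivial, hquad u hu]
      linarith [hge u hu]
    rw [hpsd.dotProduct_mulVec_zero_iff, sub_mulVec, smul_mulVec, one_mulVec,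
      sub_eq_zero] at h2
    obtain ⟨c, rfl⟩ := hsimple u h2
    have hc : c ^ 2 = 1 := by
      simpa only [Pi.smul_apply, smul_eq_mul, mul_pow, ← Finset.mul_sum, hm, mul_one] using hu
    rcases (sq_eq_sq_iff_eq_or_eq_neg.mp (hc.trans (one_pow 2).symm)) with rfl | rfl
    · simp
    · simp
  · intro hum w hw
    have hKu : u ⬝ᵥ K *ᵥ u = lam := by
      rcases hum with rfl | rfl
      · exact hKm
      · rw [mulVec_neg, neg_dotProduct_neg, hKm]
    rw [hF w hw, hF u hu, hKu]
    linarith [hge w hw]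
end
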